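/- Let 0 < δ = t_0 < t_1 < ⋯ < t_k = T be a time partition, let w_0, …, w_{k−1} ∈ ℝ be guidance strengths, and let ρ : ℝ → (Fin M → ℝ) be continuous on [δ, T] and, for each i, a reverse-dynamics solution for (R^{(w_i)}_τ) on (t_i, t_{i+1}). Then: (1) for every i, ρ t_i m = ρ t_{i+1} m · ((1 − exp(−σ̄ t_i))/(1 − exp(−σ̄ t_{i+1})))^{Z_{w_i}}; and (2) for every j ≠ m, ρ δ j = ρ T j + ∑_{i=0}^{k−1} ρ t_{i+1} m · (1 − ((1 − exp(−σ̄ t_i))/(1 − exp(−σ̄ t_{i+1})))^{Z_{w_i}}) · p^{(w_i)} j. -/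

import Mathlib

open Finset

noncomputable section GuidedMaskedDiffusion1D

variable {M : ℕ}

/-- Partition function `Z_w = ∑_{i ≠ m} (p i)^w (q i)^{1-w}`. -/
def Zw (m : Fin M) (p q : Fin M → ℝ) (w : ℝ) : ℝ :=
  ∑ i ∈ Finset.univ.filter (fun i => i ≠ m), (p i) ^ w * (q i) ^ (1 - w)

/-- Tilted distribution `p^{(w)} i = (p i)^w (q i)^{1-w} / Z_w` for `i ≠ m`, and
`p^{(w)} m = 0`. -/
def tilted (m : Fin M) (p q : Fin M → ℝ) (w : ℝ) : Fin M → ℝ :=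
  fun i => if i = m then 0 else (p i) ^ w * (q i) ^ (1 - w) / Zw m p q w

/-- Integrated noise schedule `σ̄ t = ∫_0^t σ`. -/
def sigmaBar (σ : ℝ → ℝ) (t : ℝ) : ℝ := ∫ s in (0 : ℝ)..t, σ s

/-- `c t = σ t · exp(-σ̄ t) / (1 - exp(-σ̄ t))`. -/
def cFun (σ : ℝ → ℝ) (t : ℝ) : ℝ :=
  σ t * Real.exp (-(sigmaBar σ t)) / (1 - Real.exp (-(sigmaBar σ t)))

/-- The matrix `A_w`: its column indexed by `m` has entries `(A_w) i m = p^{(w)} i` for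
`i ≠ m` and `(A_w) m m = -1`; all other columns vanish. -/
def Amat (m : Fin M) (p q : Fin M → ℝ) (w : ℝ) : Matrix (Fin M) (Fin M) ℝ :=
  fun i j => if j = m then (if i = m then -1 else tilted m p q w i) else 0

/-- The (unnormalized) guided rate matrix `R^{(w)}_t = (c t · Z_w) • A_w`. -/
def guidedRate (m : Fin M) (p q : Fin M → ℝ) (σ : ℝ → ℝ) (w t : ℝ) :
    Matrix (Fin M) (Fin M) ℝ :=
  (cFun σ t * Zw m p q w) • Amat m p q w

/-- The column-normalized guided rate matrix `R_nor^{(w)}_t = (c t) • A_w`. -/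
def guidedRateNor (m : Fin M) (p q : Fin M → ℝ) (σ : ℝ → ℝ) (w t : ℝ) :
    Matrix (Fin M) (Fin M) ℝ :=
  cFun σ t • Amat m p q w

/-- A reverse-dynamics solution for a family of rate matrices `Rfam` on an interval `I`:
a continuous `ρ` such that, at every `s` in the interior of `I`, `ρ` has derivative
`-(Rfam s).mulVec (ρ s)` at `s`. -/
def IsReverseSol (Rfam : ℝ → Matrix (Fin M) (Fin M) ℝ) (I : Set ℝ)
    (ρ : ℝ → Fin M → ℝ) : Prop :=
  ContinuousOn ρ I ∧ ∀ s ∈ interior I, HasDerivAt ρ (-((Rfam s).mulVec (ρ s))) s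

end GuidedMaskedDiffusion1D

theorem const_aux (f : ℝ → ℝ) (a b : ℝ) (hab : a < b) (hc : ContinuousOn f (Set.Icc a b))
    (hd : ∀ x ∈ Set.Ioo a b, HasDerivAt f 0 x) : f a = f b := by
  obtain ⟨c, hc, h⟩ := exists_hasDerivAt_eq_slope f (fun _ => 0) hab hc hd
  have : b - a ≠ 0 := by linarith
  field_simp at h
  linarith

theorem sigmaBar_hasDerivAt (σ : ℝ → ℝ) (hσ : Continuous σ) (t : ℝ) :
    HasDerivAt (sigmaBar σ) (σ t) t :=
  intervalIntegral.integral_hasDerivAt_right (hσ.intervalIntegrable _ _)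
    (hσ.stronglyMeasurableAtFilter _ _) hσ.continuousAt

theorem sigmaBar_pos (σ : ℝ → ℝ) (hσ : Continuous σ) (hσpos : ∀ t, 0 < t → 0 < σ t)
    (t : ℝ) (ht : 0 < t) : 0 < sigmaBar σ t :=
  intervalIntegral.intervalIntegral_pos_of_pos_on (hσ.intervalIntegrable _ _)
    (fun x hx => hσpos x hx.1) ht

theorem g_pos (σ : ℝ → ℝ) (hσ : Continuous σ) (hσpos : ∀ t, 0 < t → 0 < σ t)
    (t : ℝ) (ht : 0 < t) : 0 < 1 - Real.exp (-(sigmaBar σ t)) := by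
  have := sigmaBar_pos σ hσ hσpos t ht
  have : Real.exp (-(sigmaBar σ t)) < 1 := by
    rw [← Real.exp_zero, Real.exp_lt_exp]; linarith
  linarith

theorem g_deriv (σ : ℝ → ℝ) (hσ : Continuous σ) (t : ℝ) :
    HasDerivAt (fun t => 1 - Real.exp (-(sigmaBar σ t)))
      (σ t * Real.exp (-(sigmaBar σ t))) t := by
  have h := ((sigmaBar_hasDerivAt σ hσ t).fun_neg.exp).const_sub 1
  refine h.congr_deriv ?_
  ring

theorem rate_mulVec {M : ℕ} (m : Fin M) (p q : Fin M → ℝ) (σ : ℝ → ℝ) (w t : ℝ)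
    (v : Fin M → ℝ) (i : Fin M) :
    (guidedRate m p q σ w t).mulVec v i =
      cFun σ t * Zw m p q w * (if i = m then -1 else tilted m p q w i) * v m := by
  simp [guidedRate, Matrix.mulVec, dotProduct, Amat]

theorem step_aux {M : ℕ} (m : Fin M) (p q : Fin M → ℝ)
    (σ : ℝ → ℝ) (hσ : Continuous σ) (hσpos : ∀ t, 0 < t → 0 < σ t)
    (w a b : ℝ) (ha : 0 < a) (hab : a < b)
    (ρ : ℝ → Fin M → ℝ) (hc : ContinuousOn ρ (Set.Icc a b))
    (hsol : ∀ τ ∈ Set.Ioo a b,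
      HasDerivAt ρ (-((guidedRate m p q σ w τ).mulVec (ρ τ))) τ) :
    (ρ a m = ρ b m * ((1 - Real.exp (-(sigmaBar σ a))) /
          (1 - Real.exp (-(sigmaBar σ b)))) ^ Zw m p q w) ∧
    ∀ j, j ≠ m → ρ a j + tilted m p q w j * ρ a m = ρ b j + tilted m p q w j * ρ b m := by
  have hci : ∀ j, ContinuousOn (fun t => ρ t j) (Set.Icc a b) :=
    fun j => (continuous_apply j).comp_continuousOn hc
  have hdi : ∀ j, ∀ τ ∈ Set.Ioo a b, HasDerivAt (fun t => ρ t j)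
      (-(cFun σ τ * Zw m p q w * (if j = m then -1 else tilted m p q w j) * ρ τ m)) τ := by
    intro j τ hτ
    have h := hasDerivAt_pi.1 (hsol τ hτ) j
    rwa [Pi.neg_apply, rate_mulVec] at h
  have hgp := g_pos σ hσ hσpos
  constructor
  · have key := const_aux
      (fun t => ρ t m * (1 - Real.exp (-(sigmaBar σ t))) ^ (-Zw m p q w)) a b hab
      ((hci m).mul (ContinuousOn.rpow_const
        (fun t _ => (g_deriv σ hσ t).continuousAt.continuousWithinAt)
        (fun t ht => Or.inl (hgp t (lt_of_lt_of_le ha ht.1)).ne')))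
      (by
        intro t ht
        have hg := hgp t (ha.trans ht.1)
        have h := (hdi m t ht).fun_mul ((g_deriv σ hσ t).rpow_const (p := -Zw m p q w)
          (Or.inl hg.ne'))
        refine h.congr_deriv ?_
        rw [Real.rpow_sub_one hg.ne', cFun]
        simp only [if_true]
        field_simp
        ring)
    have hga := hgp a ha
    have hgb := hgp b (ha.trans hab)
    simp only [Real.rpow_neg hga.le, Real.rpow_neg hgb.le] at key
    have h1 := Real.rpow_pos_of_pos hga (Zw m p q w)
    have h2 := Real.rpow_pos_of_pos hgb (Zw m p q w)
    rw [Real.div_rpow hga.le hgb.le]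
    field_simp at key ⊢
    linarith
  · intro j hj
    refine const_aux (fun t => ρ t j + tilted m p q w j * ρ t m) a b hab
      ((hci j).add ((hci m).const_mul _)) ?_
    intro t ht
    have h := (hdi j t ht).fun_add ((hdi m t ht).const_mul (tilted m p q w j))
    refine h.congr_deriv ?_
    simp only [if_true, if_neg hj]
    ring

/-- Let `0 < δ = t_0 < t_1 < ⋯ < t_k = T` be a time partition, let
`w_0, …, w_{k-1}` be guidance strengths, and let `ρ` be continuous on `[δ, T]` and, for each
`i`, a reverse-dynamics solution for the (unnormalized) guided family `(R^{(w_i)}_τ)` on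
`(t_i, t_{i+1})`.  Then: (1) for every `i`,
`ρ t_i m = ρ t_{i+1} m · ((1 - exp(-σ̄ t_i))/(1 - exp(-σ̄ t_{i+1})))^{Z_{w_i}}`; and (2) for
every `j ≠ m`,
`ρ δ j = ρ T j + ∑_{i} ρ t_{i+1} m · (1 - ((1 - exp(-σ̄ t_i))/(1 - exp(-σ̄ t_{i+1})))^{Z_{w_i}}) · p^{(w_i)} j`. -/
theorem guided_reverse_dynamics_piecewise_constant_unnormalized
    (M : ℕ) (hM : 2 ≤ M) (m : Fin M) (hm : (m : ℕ) = M - 1)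
    (p q : Fin M → ℝ)
    (hp_nonneg : ∀ i, 0 ≤ p i) (hp_sum : ∑ i, p i = 1) (hpm : p m = 0)
    (hp_pos : ∀ i, i ≠ m → 0 < p i)
    (hq_nonneg : ∀ i, 0 ≤ q i) (hq_sum : ∑ i, q i = 1) (hqm : q m = 0)
    (hq_pos : ∀ i, i ≠ m → 0 < q i)
    (T : ℝ) (hT : 0 < T)
    (σ : ℝ → ℝ) (hσ : Continuous σ) (hσpos : ∀ t, 0 < t → 0 < σ t)
    (k : ℕ) (hk : 1 ≤ k)
    (ts : Fin (k + 1) → ℝ) (hts : StrictMono ts)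
    (δ : ℝ) (hδ : 0 < δ) (hts0 : ts 0 = δ) (htsk : ts (Fin.last k) = T)
    (ws : Fin k → ℝ)
    (ρ : ℝ → Fin M → ℝ) (hρcont : ContinuousOn ρ (Set.Icc δ T))
    (hρsol : ∀ i : Fin k, ∀ τ ∈ Set.Ioo (ts i.castSucc) (ts i.succ),
      HasDerivAt ρ (-((guidedRate m p q σ (ws i) τ).mulVec (ρ τ))) τ) :
    (∀ i : Fin k,
      ρ (ts i.castSucc) m = ρ (ts i.succ) m *
        ((1 - Real.exp (-(sigmaBar σ (ts i.castSucc)))) /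
          (1 - Real.exp (-(sigmaBar σ (ts i.succ))))) ^ Zw m p q (ws i)) ∧
    (∀ j, j ≠ m →
      ρ δ j = ρ T j + ∑ i : Fin k,
        ρ (ts i.succ) m *
          (1 - ((1 - Real.exp (-(sigmaBar σ (ts i.castSucc)))) /
            (1 - Real.exp (-(sigmaBar σ (ts i.succ))))) ^ Zw m p q (ws i)) *
          tilted m p q (ws i) j) := by
  have hmain : ∀ i : Fin k, _ := fun i => step_aux m p q σ hσ hσpos (ws i) (ts i.castSucc)
    (ts i.succ) (lt_of_lt_of_le hδ (hts0 ▸ hts.monotone (Fin.zero_le _)))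
    (hts i.castSucc_lt_succ) ρ
    (hρcont.mono (Set.Icc_subset_Icc (hts0 ▸ hts.monotone (Fin.zero_le _))
      (htsk ▸ hts.monotone (Fin.le_last _)))) (hρsol i)
  refine ⟨fun i => (hmain i).1, fun j hj => ?_⟩
  have hterm : ∀ i : Fin k, ρ (ts i.succ) m *
          (1 - ((1 - Real.exp (-(sigmaBar σ (ts i.castSucc)))) /
            (1 - Real.exp (-(sigmaBar σ (ts i.succ))))) ^ Zw m p q (ws i)) *
          tilted m p q (ws i) j = ρ (ts i.castSucc) j - ρ (ts i.succ) j := by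
    intro i
    have h1 := (hmain i).1
    have h2 := (hmain i).2 j hj
    rw [mul_sub, ← h1]
    linarith
  rw [Finset.sum_congr rfl (fun i _ => hterm i), Finset.sum_sub_distrib]
  have e1 := Fin.sum_univ_castSucc (fun i => ρ (ts i) j)
  have e2 := Fin.sum_univ_succ (fun i => ρ (ts i) j)
  rw [htsk] at e1
  rw [hts0] at e2
  linarith
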